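/- arXiv:2212.13811 — 4 statements merged into one kernel-verified Lean document; each statement's English description precedes it below -/
import Mathlib

section
/- The subspace Λ²_7 = {ω ∈ Λ²(ℝ^8)* : ⋆(Φ ∧ ω) = 3ω} of 2-forms on ℝ^8 has dimension 7, and the subspace Λ²_{21} = {ω ∈ Λ²(ℝ^8)* : ⋆(Φ ∧ ω) = -ω} has dimension 21; moreover Λ²(ℝ^8)* = Λ²_7 ⊕ Λ²_{21}. -/
open Finset

noncomputable section

/-- The exterior algebra of (ℝ^8)*, modeled as coefficient functions on basis index sets. -/
abbrev Form := Finset (Fin 8) → ℝ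

/-- Sign `(-1)^{#{(i,j) ∈ t × u : j < i}}` arising when merging two wedge monomials. -/
def esign (t u : Finset (Fin 8)) : ℝ :=
  (-1 : ℝ) ^ ((t ×ˢ u).filter (fun p => p.2 < p.1)).card

/-- Wedge product of forms. -/
def wedge (α β : Form) : Form := fun s =>
  ∑ t ∈ s.powerset, esign t (s \ t) * α t * β (s \ t)

/-- Hodge star for the standard Euclidean metric and orientation `e^{01234567}`,
characterized by `α ∧ ⋆β = ⟨α,β⟩ vol`. -/
def hodge (α : Form) : Form := fun u => esign uᶜ u * α uᶜ

/-- Inner product on forms, making the basis monomials orthonormal. -/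
def formInner (α β : Form) : ℝ := ∑ s : Finset (Fin 8), α s * β s

/-- Basis monomial `e^{i₁} ∧ ⋯ ∧ e^{i_k}` for `s = {i₁ < ⋯ < i_k}`. -/
def eS (s : Finset (Fin 8)) : Form := fun t => if t = s then 1 else 0

/-- `α` is a `k`-form. -/
def IsForm (k : ℕ) (α : Form) : Prop := ∀ s, s.card ≠ k → α s = 0

/-- The standard Cayley (Spin(7)) 4-form on ℝ^8. -/
def Phi : Form :=
  eS {0,1,2,3} - eS {0,1,4,5} - eS {0,1,6,7} - eS {0,2,4,6} + eS {0,2,5,7}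
  - eS {0,3,4,7} - eS {0,3,5,6} + eS {4,5,6,7} - eS {2,3,6,7} - eS {2,3,4,5}
  - eS {1,3,5,7} + eS {1,3,4,6} - eS {1,2,5,6} - eS {1,2,4,7}

/-- Interior product with the basis vector `e_i`. -/
def iota (i : Fin 8) (α : Form) : Form := fun s =>
  if i ∈ s then 0 else (-1 : ℝ) ^ (s.filter (· < i)).card * α (insert i s)

/-- Interior product with the vector `v`. -/
def iotaV (v : Fin 8 → ℝ) (α : Form) : Form := fun s => ∑ i, v i * iota i α s

/-- Musical isomorphism `♭ : ℝ^8 → Λ¹(ℝ^8)*`. -/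
def flat (v : Fin 8 → ℝ) : Form := fun s => ∑ i, v i * eS {i} s

/-- Projection onto `Λ²_7` (eigenvalue 3 of `ω ↦ ⋆(Φ ∧ ω)`). -/
def proj7 (α : Form) : Form := (4 : ℝ)⁻¹ • (α + hodge (wedge Phi α))

/-- Projection onto `Λ²_21` (eigenvalue -1 of `ω ↦ ⋆(Φ ∧ ω)`). -/
def proj21 (α : Form) : Form := (4 : ℝ)⁻¹ • ((3 : ℝ) • α - hodge (wedge Phi α))

/-- Evaluation of a 4-form on four vectors. -/
def ev4 (α : Form) (x y z w : Fin 8 → ℝ) : ℝ :=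
  iotaV w (iotaV z (iotaV y (iotaV x α))) ∅

/-- Standard inner product on ℝ^8. -/
def dot (u v : Fin 8 → ℝ) : ℝ := ∑ i, u i * v i

/-- Standard basis vector. -/
def std (i : Fin 8) : Fin 8 → ℝ := fun j => if j = i then 1 else 0

/-- Hodge star as a linear map. -/
def hodgeL : Form →ₗ[ℝ] Form where
  toFun := hodge
  map_add' α β := by funext u; simp [hodge, mul_add]
  map_smul' c α := by funext u; simp [hodge]; ring

/-- Wedge with a fixed form, as a linear map. -/
def wedgeL (α : Form) : Form →ₗ[ℝ] Form where
  toFun β := wedge α β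
  map_add' β γ := by
    funext s
    simp [wedge, mul_add, Finset.sum_add_distrib]
  map_smul' c β := by
    funext s
    simp only [wedge, Pi.smul_apply, smul_eq_mul, RingHom.id_apply]
    rw [Finset.mul_sum]
    exact Finset.sum_congr rfl fun t _ => by ring

/-- The subspace of `k`-forms. -/
def FormK (k : ℕ) : Submodule ℝ Form where
  carrier := {α | IsForm k α}
  add_mem' := by intro a b ha hb s hs; simp [Pi.add_apply, ha s hs, hb s hs]
  zero_mem' := by intro s _; rfl
  smul_mem' := by intro c α ha s hs; simp [Pi.smul_apply, ha s hs]
end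

noncomputable section

/-- `Λ²_7`: 2-forms with ⋆(Φ ∧ ω) = 3ω. -/
def Lambda2_7 : Submodule ℝ Form :=
  FormK 2 ⊓ LinearMap.ker (hodgeL ∘ₗ wedgeL Phi - (3 : ℝ) • LinearMap.id)

/-- `Λ²_21`: 2-forms with ⋆(Φ ∧ ω) = -ω. -/
def Lambda2_21 : Submodule ℝ Form :=
  FormK 2 ⊓ LinearMap.ker (hodgeL ∘ₗ wedgeL Phi + LinearMap.id)

/-- Integer version of `esign`. -/
def sgZ (t u : Finset (Fin 8)) : ℤ :=
  (-1 : ℤ) ^ ((t ×ˢ u).filter (fun p => p.2 < p.1)).card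

/-- Integer version of `eS`. -/
def eZ (s t : Finset (Fin 8)) : ℤ := if t = s then 1 else 0

/-- Integer version of `Phi`. -/
def phiZ (t : Finset (Fin 8)) : ℤ :=
  eZ {0,1,2,3} t - eZ {0,1,4,5} t - eZ {0,1,6,7} t - eZ {0,2,4,6} t + eZ {0,2,5,7} t
  - eZ {0,3,4,7} t - eZ {0,3,5,6} t + eZ {4,5,6,7} t - eZ {2,3,6,7} t - eZ {2,3,4,5} t
  - eZ {1,3,5,7} t + eZ {1,3,4,6} t - eZ {1,2,5,6} t - eZ {1,2,4,7} t

/-- Matrix coefficients of `ω ↦ ⋆(Φ ∧ ω)`. -/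
def mZ (u w : Finset (Fin 8)) : ℤ :=
  if w ⊆ uᶜ then sgZ uᶜ u * sgZ (uᶜ \ w) w * phiZ (uᶜ \ w) else 0

/-- The 28 pairs of indices, arranged in seven blocks of four. -/
def blk : Fin 7 × Fin 4 → Finset (Fin 8) := fun p =>
  (![![{0,1},{2,3},{4,5},{6,7}], ![{0,2},{1,3},{4,6},{5,7}], ![{0,3},{1,2},{4,7},{5,6}],
     ![{0,4},{1,5},{2,6},{3,7}], ![{0,5},{1,4},{2,7},{3,6}], ![{0,6},{1,7},{2,4},{3,5}],
     ![{0,7},{1,6},{2,5},{3,4}]] : Fin 7 → Fin 4 → Finset (Fin 8)) p.1 p.2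

/-- Signs of the pairs. -/
def sg : Fin 7 × Fin 4 → ℤ := fun p =>
  (![![1,1,-1,-1], ![1,-1,-1,1], ![1,1,-1,-1], ![1,1,1,1], ![1,-1,-1,1], ![1,1,-1,-1],
     ![1,-1,1,-1]] : Fin 7 → Fin 4 → ℤ) p.1 p.2

lemma esign_cast (t u : Finset (Fin 8)) : esign t u = (sgZ t u : ℝ) := by
  simp [esign, sgZ]

lemma eS_cast (s t : Finset (Fin 8)) : eS s t = (eZ s t : ℝ) := by
  simp [eS, eZ]

lemma Phi_cast (t : Finset (Fin 8)) : Phi t = (phiZ t : ℝ) := by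
  simp [Phi, phiZ, eS_cast]

lemma blk_inj : Function.Injective blk := by
  unfold Function.Injective
  decide +kernel

lemma blk_card : ∀ p, (blk p).card = 2 := by
  decide +kernel

lemma blk_image : univ.image blk = univ.filter (fun s : Finset (Fin 8) => s.card = 2) := by
  apply Finset.eq_of_subset_of_card_le
  · intro s hs
    obtain ⟨p, -, rfl⟩ := Finset.mem_image.1 hs
    simp [blk_card]
  · rw [Finset.card_image_of_injective _ blk_inj]
    rw [← Finset.powerset_univ, ← Finset.powersetCard_eq_filter, Finset.card_powersetCard]
    simp [Nat.choose]

lemma exists_blk {s : Finset (Fin 8)} (hs : s.card = 2) : ∃ p, blk p = s := by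
  have : s ∈ univ.image blk := by rw [blk_image]; simp [hs]
  simpa using this

lemma mZ_blk : ∀ p q, mZ (blk p) (blk q) =
    (if p.1 = q.1 then sg p * sg q else 0) - if p = q then 1 else 0 := by
  decide +kernel

lemma sg_sq : ∀ p, sg p * sg p = 1 := by
  decide +kernel

lemma sg_sqR (p) : (sg p : ℝ) * sg p = 1 := by
  exact_mod_cast sg_sq p

lemma star_eq_sum (ω : Form) (u : Finset (Fin 8)) :
    hodge (wedge Phi ω) u = ∑ w, (mZ u w : ℝ) * ω w := by
  have h : ∑ w, (mZ u w : ℝ) * ω w = ∑ w ∈ (uᶜ).powerset,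
      (sgZ uᶜ u * sgZ (uᶜ \ w) w * phiZ (uᶜ \ w) : ℝ) * ω w := by
    rw [← Finset.sum_subset (Finset.subset_univ (uᶜ).powerset)]
    · refine Finset.sum_congr rfl fun w hw => ?_
      rw [mZ, if_pos (Finset.mem_powerset.1 hw)]
      push_cast
      rfl
    · intro w _ hw
      rw [mZ, if_neg (by simpa using hw)]
      simp
  rw [h, hodge, wedge, Finset.mul_sum]
  refine Finset.sum_bij' (fun t _ => uᶜ \ t) (fun t _ => uᶜ \ t) ?_ ?_ ?_ ?_ ?_
  · intro t _
    exact Finset.mem_powerset.2 Finset.sdiff_subset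
  · intro t _
    exact Finset.mem_powerset.2 Finset.sdiff_subset
  · intro t ht
    exact Finset.sdiff_sdiff_eq_self (Finset.mem_powerset.1 ht)
  · intro t ht
    exact Finset.sdiff_sdiff_eq_self (Finset.mem_powerset.1 ht)
  · intro t ht
    rw [Finset.sdiff_sdiff_eq_self (Finset.mem_powerset.1 ht), esign_cast, esign_cast, Phi_cast]
    ring

lemma phiZ_card {t : Finset (Fin 8)} (h : t.card ≠ 4) : phiZ t = 0 := by
  have key : ∀ s : Finset (Fin 8), s.card = 4 → eZ s t = 0 := by
    intro s hs
    rw [eZ, if_neg]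
    rintro rfl
    exact h hs
  unfold phiZ
  simp (discharger := decide) only [key]
  norm_num

lemma mZ_card {u w : Finset (Fin 8)} (hw : w.card = 2) (hu : u.card ≠ 2) : mZ u w = 0 := by
  rw [mZ]
  split_ifs with h
  · rw [phiZ_card, mul_zero]
    have h1 := Finset.card_sdiff_add_card_eq_card h
    have h2 := Finset.card_add_card_compl u
    simp only [Fintype.card_fin] at h2
    omega
  · rfl

lemma sum_two {ω : Form} (hω : IsForm 2 ω) (f : Finset (Fin 8) → ℝ) :
    ∑ w, f w * ω w = ∑ p, f (blk p) * ω (blk p) := by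
  rw [← Finset.sum_image (s := univ) (f := fun w => f w * ω w) (g := blk) (blk_inj.injOn),
    blk_image]
  symm
  apply Finset.sum_subset (Finset.subset_univ _)
  intro w _ hw
  rw [hω w (by simpa using hw), mul_zero]

/-- Block sums. -/
def blockS : Form →ₗ[ℝ] (Fin 7 → ℝ) where
  toFun ω := fun k => ∑ j, (sg (k, j) : ℝ) * ω (blk (k, j))
  map_add' α β := by funext k; simp [mul_add, Finset.sum_add_distrib]
  map_smul' c α := by
    funext k
    simp only [Pi.smul_apply, smul_eq_mul, RingHom.id_apply]
    rw [Finset.mul_sum]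
    exact Finset.sum_congr rfl fun j _ => by ring

/-- The 2-form that is constant (up to signs) on each block. -/
def blockE : (Fin 7 → ℝ) →ₗ[ℝ] Form where
  toFun c := fun s => ∑ p, if blk p = s then (sg p : ℝ) * c p.1 else 0
  map_add' a b := by
    funext s
    simp only [Pi.add_apply, ← Finset.sum_add_distrib]
    exact Finset.sum_congr rfl fun p _ => by split_ifs <;> ring
  map_smul' c a := by
    funext s
    simp only [Pi.smul_apply, smul_eq_mul, RingHom.id_apply, Finset.mul_sum]
    exact Finset.sum_congr rfl fun p _ => by split_ifs <;> ring

lemma blockE_blk (c : Fin 7 → ℝ) (p) : blockE c (blk p) = sg p * c p.1 := by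
  change (∑ q, if blk q = blk p then (sg q : ℝ) * c q.1 else 0) = _
  simp [blk_inj.eq_iff]

lemma blockE_mem (c : Fin 7 → ℝ) : blockE c ∈ FormK 2 := by
  intro s hs
  change (∑ q, if blk q = s then (sg q : ℝ) * c q.1 else 0) = 0
  refine Finset.sum_eq_zero fun q _ => if_neg ?_
  rintro rfl
  exact hs (blk_card q)

lemma blockS_blockE (c : Fin 7 → ℝ) : blockS (blockE c) = (4 : ℝ) • c := by
  funext k
  change ∑ j, (sg (k, j) : ℝ) * blockE c (blk (k, j)) = 4 * c k
  simp only [blockE_blk, ← mul_assoc, sg_sqR]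
  simp

lemma star_eq {ω : Form} (hω : ω ∈ FormK 2) :
    (hodgeL ∘ₗ wedgeL Phi) ω = blockE (blockS ω) - ω := by
  funext u
  change hodge (wedge Phi ω) u = blockE (blockS ω) u - ω u
  rw [star_eq_sum, sum_two hω (fun w => (mZ u w : ℝ))]
  by_cases hu : u.card = 2
  · obtain ⟨p, rfl⟩ := exists_blk hu
    rw [blockE_blk]
    change _ = (sg p : ℝ) * (∑ j, (sg (p.1, j) : ℝ) * ω (blk (p.1, j))) - _
    simp only [mZ_blk]
    push_cast
    simp only [sub_mul, Finset.sum_sub_distrib, ite_mul, zero_mul, one_mul]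
    congr 1
    · rw [Fintype.sum_prod_type]
      simp only [Finset.sum_ite_irrel, Finset.sum_const_zero, Finset.sum_ite_eq, Finset.mem_univ,
        if_true, Finset.mul_sum, mul_assoc]
    · simp
  · rw [hω u hu, blockE_mem _ u hu, sub_zero]
    refine Finset.sum_eq_zero fun p _ => ?_
    rw [mZ_card (blk_card p) hu]
    simp

lemma mem_seven {ω : Form} : ω ∈ Lambda2_7 ↔ ω ∈ FormK 2 ∧ blockE (blockS ω) = (4 : ℝ) • ω := by
  rw [Lambda2_7, Submodule.mem_inf]
  refine and_congr_right fun h => ?_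
  rw [LinearMap.mem_ker, LinearMap.sub_apply, star_eq h, LinearMap.smul_apply, LinearMap.id_apply]
  constructor
  · intro e
    rw [← sub_eq_zero, ← e]
    module
  · intro e
    rw [e]
    module

lemma mem_twentyone {ω : Form} : ω ∈ Lambda2_21 ↔ ω ∈ FormK 2 ∧ blockE (blockS ω) = 0 := by
  rw [Lambda2_21, Submodule.mem_inf]
  refine and_congr_right fun h => ?_
  rw [LinearMap.mem_ker, LinearMap.add_apply, star_eq h, LinearMap.id_apply, sub_add_cancel]

lemma seven_eq_range : Lambda2_7 = LinearMap.range blockE := by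
  ext ω
  rw [mem_seven, LinearMap.mem_range]
  constructor
  · rintro ⟨-, h⟩
    refine ⟨(4 : ℝ)⁻¹ • blockS ω, ?_⟩
    rw [map_smul, h, smul_smul]
    norm_num
  · rintro ⟨c, rfl⟩
    exact ⟨blockE_mem c, by rw [blockS_blockE, map_smul]⟩

lemma blockE_inj : Function.Injective blockE := by
  intro a b h
  have h2 : (4 : ℝ) • a = (4 : ℝ) • b := by rw [← blockS_blockE, ← blockS_blockE, h]
  exact smul_right_injective _ (by norm_num : (4 : ℝ) ≠ 0) h2

lemma finrank_seven : Module.finrank ℝ Lambda2_7 = 7 := by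
  rw [seven_eq_range, LinearMap.finrank_range_of_inj blockE_inj]
  simp

/-- A 2-form is the same as its coefficients on the 28 pairs. -/
def twoEquiv : FormK 2 ≃ₗ[ℝ] (Fin 7 × Fin 4 → ℝ) :=
  LinearEquiv.ofBijective ((LinearMap.funLeft ℝ ℝ blk) ∘ₗ (FormK 2).subtype) (by
    constructor
    · intro a b h
      apply Subtype.ext
      funext s
      by_cases hs : s.card = 2
      · obtain ⟨p, rfl⟩ := exists_blk hs
        exact congrFun h p
      · rw [a.2 s hs, b.2 s hs]
    · intro c
      refine ⟨⟨fun s => ∑ p, if blk p = s then c p else 0, ?_⟩, ?_⟩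
      · intro s hs
        refine Finset.sum_eq_zero fun q _ => if_neg ?_
        rintro rfl
        exact hs (blk_card q)
      · funext p
        change (∑ q, if blk q = blk p then c q else 0) = c p
        simp [blk_inj.eq_iff])

lemma finrank_two : Module.finrank ℝ (FormK 2) = 28 := by
  rw [twoEquiv.finrank_eq]
  simp

lemma sup_eq : Lambda2_7 ⊔ Lambda2_21 = FormK 2 := by
  apply le_antisymm
  · exact sup_le inf_le_left inf_le_left
  · intro ω hω
    rw [Submodule.mem_sup]
    refine ⟨blockE ((4 : ℝ)⁻¹ • blockS ω), ?_, ω - blockE ((4 : ℝ)⁻¹ • blockS ω), ?_, ?_⟩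
    · rw [seven_eq_range]
      exact ⟨_, rfl⟩
    · rw [mem_twentyone]
      refine ⟨Submodule.sub_mem _ hω (blockE_mem _), ?_⟩
      rw [map_sub, blockS_blockE, smul_smul]
      norm_num
    · abel

lemma inf_eq : Lambda2_7 ⊓ Lambda2_21 = ⊥ := by
  rw [eq_bot_iff]
  rintro ω ⟨h7, h21⟩
  have h := (mem_seven.1 h7).2
  rw [(mem_twentyone.1 h21).2] at h
  rw [Submodule.mem_bot]
  exact (smul_eq_zero.1 h.symm).resolve_left (by norm_num)

/-- dim Λ²_7 = 7, dim Λ²_21 = 21, and Λ²(ℝ^8)* = Λ²_7 ⊕ Λ²_21. -/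
theorem lambda2_decomposition :
    Module.finrank ℝ Lambda2_7 = 7 ∧
    Module.finrank ℝ Lambda2_21 = 21 ∧
    Lambda2_7 ⊔ Lambda2_21 = FormK 2 ∧
    Lambda2_7 ⊓ Lambda2_21 = ⊥ := by
  refine ⟨finrank_seven, ?_, sup_eq, inf_eq⟩
  have h := Submodule.finrank_sup_add_finrank_inf_eq Lambda2_7 Lambda2_21
  rw [sup_eq, inf_eq, finrank_two, finrank_seven, finrank_bot] at h
  omega

end
end

section
/- For the Cayley 4-form Φ on ℝ^8 and any vectors v, w ∈ ℝ^8: (v⌟w⌟Φ) ∧ Φ = -(v⌟Φ) ∧ (w⌟Φ) - 7⋆(v^♭ ∧ w^♭). -/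
open Finset

noncomputable section


namespace CayleyAux

/-! Linearity of the operations. -/

def wedgeL : Form →ₗ[ℝ] Form →ₗ[ℝ] Form :=
  LinearMap.mk₂ ℝ wedge
    (fun a b c => by
      funext s; simp only [wedge, Pi.add_apply, ← Finset.sum_add_distrib]
      exact Finset.sum_congr rfl fun _ _ => by ring)
    (fun r a b => by
      funext s; simp only [wedge, Pi.smul_apply, smul_eq_mul, Finset.mul_sum]
      exact Finset.sum_congr rfl fun _ _ => by ring)
    (fun a b c => by
      funext s; simp only [wedge, Pi.add_apply, ← Finset.sum_add_distrib]
      exact Finset.sum_congr rfl fun _ _ => by ring)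
    (fun r a b => by
      funext s; simp only [wedge, Pi.smul_apply, smul_eq_mul, Finset.mul_sum]
      exact Finset.sum_congr rfl fun _ _ => by ring)

def iotaL (i : Fin 8) : Form →ₗ[ℝ] Form where
  toFun := iota i
  map_add' a b := by
    funext s; simp only [iota, Pi.add_apply]; split_ifs <;> ring
  map_smul' r a := by
    funext s; simp only [iota, Pi.smul_apply, smul_eq_mul, RingHom.id_apply]; split_ifs <;> ring

def hodgeL : Form →ₗ[ℝ] Form where
  toFun := hodge
  map_add' a b := by
    funext s; simp only [hodge, Pi.add_apply]; ring
  map_smul' r a := by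
    funext s; simp only [hodge, Pi.smul_apply, smul_eq_mul, RingHom.id_apply]; ring

theorem wedge_eq (a b : Form) : wedge a b = wedgeL a b := rfl
theorem iota_eq (i : Fin 8) (a : Form) : iota i a = iotaL i a := rfl
theorem hodge_eq (a : Form) : hodge a = hodgeL a := rfl

theorem iotaV_eq (v : Fin 8 → ℝ) (a : Form) : iotaV v a = ∑ i, v i • iotaL i a := by
  funext s
  simp [iotaV, iota_eq, Finset.sum_apply]

theorem flat_eq (v : Fin 8 → ℝ) : flat v = ∑ i, v i • eS {i} := by
  funext s
  simp [flat, Finset.sum_apply]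

/-! Action on monomials. -/

theorem iota_eS (i : Fin 8) (a : Finset (Fin 8)) :
    iota i (eS a) =
      if i ∈ a then ((-1 : ℝ) ^ (a.filter (· < i)).card) • eS (a.erase i) else 0 := by
  funext s
  by_cases hi : i ∈ a
  · simp only [iota, eS, hi, if_true, Pi.smul_apply, smul_eq_mul]
    by_cases hs : i ∈ s
    · have : s ≠ a.erase i := by rintro rfl; simp at hs
      simp [hs, this]
    · by_cases h : s = a.erase i
      · subst h
        have h2 : (a.erase i).filter (· < i) = a.filter (· < i) := by
          ext k; simp only [Finset.mem_filter, Finset.mem_erase]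
          constructor
          · rintro ⟨⟨_, h⟩, h'⟩; exact ⟨h, h'⟩
          · rintro ⟨h, h'⟩; exact ⟨⟨ne_of_lt h', h⟩, h'⟩
        simp [Finset.insert_erase hi, h2]
      · have : insert i s ≠ a := by
          rintro rfl; exact h (Finset.erase_insert hs).symm
        simp [hs, h, this]
  · have : insert i s ≠ a := by rintro rfl; simp at hi
    simp [iota, eS, hi, this]

theorem wedge_eS (a b : Finset (Fin 8)) :
    wedge (eS a) (eS b) = if Disjoint a b then esign a b • eS (a ∪ b) else 0 := by
  funext s
  have key : wedge (eS a) (eS b) s =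
      if a ⊆ s ∧ s \ a = b then esign a b else 0 := by
    simp only [wedge, eS]
    by_cases ha : a ⊆ s
    · rw [Finset.sum_eq_single a]
      · by_cases hb : s \ a = b
        · simp [ha, hb]
        · simp [hb]
      · intro t _ ht; simp [ht]
      · intro h; exact absurd (Finset.mem_powerset.2 ha) h
    · rw [Finset.sum_eq_zero]
      · simp [ha]
      · intro t ht
        have : t ≠ a := by rintro rfl; exact ha (Finset.mem_powerset.1 ht)
        simp [this]
  rw [key]
  have iff1 : (a ⊆ s ∧ s \ a = b) ↔ (Disjoint a b ∧ s = a ∪ b) := by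
    constructor
    · rintro ⟨h, rfl⟩
      exact ⟨Finset.disjoint_sdiff, (Finset.union_sdiff_of_subset h).symm⟩
    · rintro ⟨h, rfl⟩
      exact ⟨Finset.subset_union_left, Finset.union_sdiff_cancel_left h⟩
  rw [if_congr iff1 rfl rfl]
  by_cases h : Disjoint a b <;> simp [h, eS]

theorem hodge_eS (a : Finset (Fin 8)) : hodge (eS a) = esign a aᶜ • eS aᶜ := by
  funext s
  simp only [hodge, eS, Pi.smul_apply, smul_eq_mul]
  by_cases h : s = aᶜ
  · subst h; simp
  · have : sᶜ ≠ a := by rintro rfl; simp at h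
    simp [h, this]

/-! Bit mask encoding. -/

def S (m : ℕ) : Finset (Fin 8) := Finset.univ.filter fun i => m.testBit i.val = true

theorem mem_S (m : ℕ) (i : Fin 8) : i ∈ S m ↔ m.testBit i.val = true := by simp [S]

def P8 (f : Fin 8 → ℤ) : ℤ := f 0 * f 1 * f 2 * f 3 * f 4 * f 5 * f 6 * f 7

theorem P8_eq (f : Fin 8 → ℤ) : P8 f = ∏ i, f i := (Fin.prod_univ_eight f).symm

def isg (i : Fin 8) (m : ℕ) : ℤ :=
  P8 fun k => if (m.testBit k.val && Nat.blt k.val i.val) = true then -1 else 1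

def sg (t u : ℕ) : ℤ :=
  P8 fun i => bif t.testBit i.val then isg i u else 1

theorem isg_eq (i : Fin 8) (m : ℕ) :
    ((isg i m : ℤ) : ℝ) = (-1 : ℝ) ^ ((S m).filter (· < i)).card := by
  rw [isg, P8_eq, ← Finset.prod_const, S, Finset.filter_filter, Finset.prod_filter]
  push_cast
  refine Finset.prod_congr rfl fun k _ => ?_
  simp [Nat.blt_eq]

theorem sg_eq (t u : ℕ) : ((sg t u : ℤ) : ℝ) = esign (S t) (S u) := by
  rw [sg, P8_eq, esign, ← Finset.prod_const, Finset.prod_filter, Finset.prod_product]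
  push_cast
  conv_rhs => rw [S, Finset.prod_filter]
  refine Finset.prod_congr rfl fun i _ => ?_
  cases h : t.testBit i.val
  · simp
  · simp only [cond_true, if_true]
    rw [isg_eq, ← Finset.prod_const, Finset.prod_filter]

theorem S_erase (m : ℕ) (i : Fin 8) (h : m.testBit i.val = true) :
    (S m).erase i = S (m ^^^ 2 ^ i.val) := by
  ext k
  simp only [Finset.mem_erase, mem_S, Nat.testBit_xor, Nat.testBit_two_pow]
  by_cases hk : k = i
  · subst hk; simp [h]
  · have : ¬ (i.val = k.val) := fun e => hk (Fin.ext e.symm)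
    simp [hk, this]

theorem S_union (a b : ℕ) : S a ∪ S b = S (a ||| b) := by
  ext k; simp [mem_S]

theorem S_compl (a : ℕ) : (S a)ᶜ = S (255 ^^^ a) := by
  ext k
  have : (255 : ℕ).testBit k.val = true := by clear * -; revert k; decide
  simp [mem_S, this]

theorem S_disjoint (a b : ℕ) : Disjoint (S a) (S b) ↔ S (a &&& b) = ∅ := by
  rw [Finset.disjoint_iff_inter_eq_empty]
  have : S a ∩ S b = S (a &&& b) := by ext k; simp [mem_S]
  rw [this]

/-! Lists of monomials. -/

abbrev L := List (ℕ × ℤ)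

def tf (l : L) : Form := (l.map fun p => (p.2 : ℝ) • eS (S p.1)).sum

@[simp] theorem tf_nil : tf [] = 0 := rfl
@[simp] theorem tf_cons (p : ℕ × ℤ) (l : L) : tf (p :: l) = (p.2 : ℝ) • eS (S p.1) + tf l := by
  simp [tf]
@[simp] theorem tf_append (l l' : L) : tf (l ++ l') = tf l + tf l' := by
  simp [tf]

def iotaM (i : Fin 8) : L → L
  | [] => []
  | p :: l => bif p.1.testBit i.val then (p.1 ^^^ 2 ^ i.val, p.2 * isg i p.1) :: iotaM i l
      else iotaM i l

theorem tf_iota (i : Fin 8) (l : L) : iotaL i (tf l) = tf (iotaM i l) := by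
  induction l with
  | nil => simp [iotaM]
  | cons p l ih =>
    rw [tf_cons, map_add, map_smul, ih, ← iota_eq, iota_eS]
    cases h : p.1.testBit i.val
    · simp [iotaM, h, mem_S]
    · simp only [iotaM, h, mem_S, if_true, cond_true, tf_cons]
      rw [S_erase _ _ h, ← isg_eq, smul_smul]
      push_cast; rfl

def scaleM (c : ℤ) (l : L) : L := l.map fun p => (p.1, c * p.2)

theorem tf_scale (c : ℤ) (l : L) : tf (scaleM c l) = (c : ℝ) • tf l := by
  induction l with
  | nil => simp [scaleM]
  | cons p l ih =>
    have : scaleM c (p :: l) = (p.1, c * p.2) :: scaleM c l := rfl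
    rw [this, tf_cons, tf_cons, ih, smul_add, smul_smul]; push_cast; rfl

def wedge1 (p : ℕ × ℤ) : L → L
  | [] => []
  | q :: l => bif Nat.beq (p.1 &&& q.1) 0 then
      (p.1 ||| q.1, p.2 * q.2 * sg p.1 q.1) :: wedge1 p l
      else bif Nat.beq ((p.1 &&& q.1) &&& 255) 0 then
      (p.1 ||| q.1, p.2 * q.2 * sg p.1 q.1) :: wedge1 p l
      else wedge1 p l

theorem S_empty_iff (a : ℕ) : S a = ∅ ↔ a &&& 255 = 0 := by
  constructor
  · intro h
    apply Nat.eq_of_testBit_eq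
    intro j
    rw [Nat.testBit_and, show (255 : ℕ) = 2 ^ 8 - 1 from rfl, Nat.testBit_two_pow_sub_one]
    by_cases hj : j < 8
    · have := (mem_S a ⟨j, hj⟩).not.1 (by rw [h]; simp)
      simp at this
      simp [this]
    · simp [hj]
  · intro h
    ext k
    have h2 : (a &&& 255).testBit k.val = false := by rw [h]; simp
    have : (255 : ℕ).testBit k.val = true := by clear * -; revert k; decide
    rw [Nat.testBit_and, this] at h2
    simp at h2
    simp [mem_S, h2]

theorem tf_wedge1 (p : ℕ × ℤ) (l : L) :
    wedgeL ((p.2 : ℝ) • eS (S p.1)) (tf l) = tf (wedge1 p l) := by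
  induction l with
  | nil => simp [wedge1]
  | cons q l ih =>
    rw [tf_cons, map_add, ih, map_smul, map_smul, LinearMap.smul_apply, ← wedge_eq, wedge_eS]
    by_cases h : (p.1 &&& q.1) &&& 255 = 0
    · have hd : Disjoint (S p.1) (S q.1) := by rw [S_disjoint, S_empty_iff]; exact h
      have e : wedge1 p (q :: l) = (p.1 ||| q.1, p.2 * q.2 * sg p.1 q.1) :: wedge1 p l := by
        rw [wedge1, show Nat.beq ((p.1 &&& q.1) &&& 255) 0 = true from by rw [h]; rfl]
        simp
      rw [if_pos hd, e, tf_cons, S_union]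
      push_cast
      rw [sg_eq, smul_smul, smul_smul]
      congr 2; ring
    · have hd : ¬ Disjoint (S p.1) (S q.1) := by rw [S_disjoint, S_empty_iff]; exact h
      have h0 : ¬ (p.1 &&& q.1 = 0) := by intro e; rw [e] at h; simp at h
      have e1 : Nat.beq ((p.1 &&& q.1) &&& 255) 0 = false := by
        rw [Bool.eq_false_iff]; intro e; exact h (Nat.eq_of_beq_eq_true e)
      have e2 : Nat.beq (p.1 &&& q.1) 0 = false := by
        rw [Bool.eq_false_iff]; intro e; exact h0 (Nat.eq_of_beq_eq_true e)
      rw [if_neg hd, wedge1, e1, e2]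
      simp

def wedgeM : L → L → L
  | [], _ => []
  | p :: l, l' => wedge1 p l' ++ wedgeM l l'

theorem tf_wedge (l l' : L) : wedgeL (tf l) (tf l') = tf (wedgeM l l') := by
  induction l with
  | nil => simp [wedgeM]
  | cons p l ih =>
    rw [tf_cons, map_add, LinearMap.add_apply, ih, tf_wedge1, wedgeM, tf_append]

def hodgeM (l : L) : L := l.map fun p => (255 ^^^ p.1, p.2 * sg p.1 (255 ^^^ p.1))

theorem tf_hodge (l : L) : hodgeL (tf l) = tf (hodgeM l) := by
  induction l with
  | nil => simp [hodgeM]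
  | cons p l ih =>
    have : hodgeM (p :: l) = (255 ^^^ p.1, p.2 * sg p.1 (255 ^^^ p.1)) :: hodgeM l := rfl
    rw [tf_cons, map_add, ih, map_smul, ← hodge_eq, hodge_eS, S_compl, ← sg_eq, this, tf_cons,
      smul_smul]
    push_cast; rfl

def ins (p : ℕ × ℤ) : L → L
  | [] => [p]
  | q :: l => bif Nat.beq p.1 q.1 then (q.1, p.2 + q.2) :: l else q :: ins p l

theorem tf_ins (p : ℕ × ℤ) (l : L) : tf (ins p l) = (p.2 : ℝ) • eS (S p.1) + tf l := by
  induction l with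
  | nil => simp [ins]
  | cons q l ih =>
    cases h : Nat.beq p.1 q.1
    · simp only [ins, h, cond_false, tf_cons, ih]; abel
    · have h' := Nat.eq_of_beq_eq_true h
      rw [ins, h, cond_true, tf_cons, tf_cons, h']
      push_cast; rw [add_smul, add_assoc]

def norm : L → L
  | [] => []
  | p :: l => ins p (norm l)

theorem tf_norm (l : L) : tf (norm l) = tf l := by
  induction l with
  | nil => rfl
  | cons p l ih => rw [norm, tf_ins, ih, tf_cons]

def allZero (l : L) : Bool := (norm l).all fun p => decide (p.2 = 0)

theorem tf_allZero (l : L) (h : allZero l = true) : tf l = 0 := by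
  rw [← tf_norm]
  simp only [allZero, List.all_eq_true, decide_eq_true_eq] at h
  generalize norm l = k at h
  induction k with
  | nil => rfl
  | cons p k ih =>
    rw [tf_cons, ih fun q hq => h q (List.mem_cons_of_mem _ hq), h p List.mem_cons_self]
    simp

/-! The Cayley form as a list. -/

def PhiM : L :=
  [(15, 1), (51, -1), (195, -1), (85, -1), (165, 1), (153, -1), (105, -1), (240, 1),
   (204, -1), (60, -1), (170, -1), (90, 1), (102, -1), (150, -1)]

theorem Phi_eq : Phi = tf PhiM := by
  have e (m : ℕ) (s : Finset (Fin 8)) (h : S m = s) : eS s = eS (S m) := by rw [h]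
  rw [Phi, e 15 {0,1,2,3} (by decide +kernel), e 51 {0,1,4,5} (by decide +kernel),
    e 195 {0,1,6,7} (by decide +kernel), e 85 {0,2,4,6} (by decide +kernel),
    e 165 {0,2,5,7} (by decide +kernel), e 153 {0,3,4,7} (by decide +kernel),
    e 105 {0,3,5,6} (by decide +kernel), e 240 {4,5,6,7} (by decide +kernel),
    e 204 {2,3,6,7} (by decide +kernel), e 60 {2,3,4,5} (by decide +kernel),
    e 170 {1,3,5,7} (by decide +kernel), e 90 {1,3,4,6} (by decide +kernel),
    e 102 {1,2,5,6} (by decide +kernel), e 150 {1,2,4,7} (by decide +kernel)]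
  simp only [PhiM, tf_cons, tf_nil]
  push_cast
  simp only [one_smul, neg_smul]
  abel

theorem single_eq (i : Fin 8) : eS {i} = tf [(2 ^ i.val, 1)] := by
  have : S (2 ^ i.val) = {i} := by revert i; decide +kernel
  simp [this]

def total (i j : Fin 8) : L :=
  wedgeM (iotaM i (iotaM j PhiM)) PhiM ++
    (wedgeM (iotaM i PhiM) (iotaM j PhiM) ++
      scaleM 7 (hodgeM (wedgeM [(2 ^ i.val, 1)] [(2 ^ j.val, 1)])))

theorem total_zero : ∀ i j : Fin 8, allZero (total i j) = true := by decide +kernel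

theorem basis_case (i j : Fin 8) :
    wedgeL (iotaL i (iotaL j Phi)) Phi =
      -(wedgeL (iotaL i Phi) (iotaL j Phi)) - (7 : ℝ) • hodgeL (wedgeL (eS {i}) (eS {j})) := by
  have h := tf_allZero _ (total_zero i j)
  rw [total, tf_append, tf_append, tf_scale, ← tf_hodge, ← tf_wedge, ← tf_wedge, ← tf_wedge,
    ← tf_iota, ← tf_iota, ← tf_iota, ← Phi_eq, ← single_eq, ← single_eq] at h
  push_cast at h
  rw [eq_neg_of_add_eq_zero_left h]
  abel

end CayleyAux

open CayleyAux in
/-- for all vectors v, w,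
(v⌟w⌟Φ) ∧ Φ = -(v⌟Φ) ∧ (w⌟Φ) - 7 ⋆(v♭ ∧ w♭). -/
theorem double_contraction_wedge_phi (v w : Fin 8 → ℝ) :
    wedge (iotaV v (iotaV w Phi)) Phi =
      -(wedge (iotaV v Phi) (iotaV w Phi)) - (7 : ℝ) • hodge (wedge (flat v) (flat w)) := by
  simp only [wedge_eq, hodge_eq, iotaV_eq, flat_eq, map_sum, map_smul, LinearMap.sum_apply,
    LinearMap.smul_apply, basis_case, Finset.smul_sum, ← Finset.sum_neg_distrib,
    ← Finset.sum_sub_distrib]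
  rw [Finset.sum_comm]
  refine Finset.sum_congr rfl fun j _ => Finset.sum_congr rfl fun i _ => ?_
  module

end
end

section
/- For the Cayley 4-form Φ on ℝ^8 and any 2-form η: (η⌟Φ) ∧ Φ = 9⋆η_7 + ⋆η_{21}, where η⌟Φ denotes the 2-form ⋆(Φ ∧ η) and η_7 = (1/4)(η + ⋆(Φ ∧ η)), η_{21} = (1/4)(3η - ⋆(Φ ∧ η)). -/
open Finset

noncomputable section

/-- The wedge product is additive on the left. -/
lemma wedge_add_left (α β γ : Form) : wedge (α + β) γ = wedge α γ + wedge β γ := by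
  funext s
  simp only [wedge, Pi.add_apply, ← Finset.sum_add_distrib]
  exact Finset.sum_congr rfl fun t _ => by ring

lemma wedge_sub_left (α β γ : Form) : wedge (α - β) γ = wedge α γ - wedge β γ := by
  funext s
  simp only [wedge, Pi.sub_apply, ← Finset.sum_sub_distrib]
  exact Finset.sum_congr rfl fun t _ => by ring

lemma wedge_add_right (α β γ : Form) : wedge γ (α + β) = wedge γ α + wedge γ β := by
  funext s
  simp only [wedge, Pi.add_apply, ← Finset.sum_add_distrib]
  exact Finset.sum_congr rfl fun t _ => by ring

lemma wedge_sub_right (α β γ : Form) : wedge γ (α - β) = wedge γ α - wedge γ β := by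
  funext s
  simp only [wedge, Pi.sub_apply, ← Finset.sum_sub_distrib]
  exact Finset.sum_congr rfl fun t _ => by ring

/-- Wedging a monomial from the left. -/
lemma wedge_eS_left (q : Finset (Fin 8)) (β : Form) (s : Finset (Fin 8)) :
    wedge (eS q) β s = if q ⊆ s then esign q (s \ q) * β (s \ q) else 0 := by
  simp [wedge, eS, Finset.sum_ite_eq']

/-- Wedging a monomial from the right. -/
lemma wedge_eS_right (q : Finset (Fin 8)) (β : Form) (s : Finset (Fin 8)) :
    wedge β (eS q) s = if q ⊆ s then esign (s \ q) q * β (s \ q) else 0 := by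
  unfold wedge eS
  split_ifs with h
  · rw [Finset.sum_eq_single (s \ q)]
    · rw [Finset.sdiff_sdiff_eq_self h]; simp
    · intro t ht hne
      have : s \ t ≠ q := by
        rintro rfl
        exact hne (Finset.sdiff_sdiff_eq_self (Finset.mem_powerset.1 ht)).symm
      simp [this]
    · intro h'; exact absurd (Finset.mem_powerset.2 Finset.sdiff_subset) h'
  · refine Finset.sum_eq_zero fun t _ => ?_
    have : s \ t ≠ q := by rintro rfl; exact h Finset.sdiff_subset
    simp [this]

lemma esign_even {t u : Finset (Fin 8)}
    (h : ((t ×ˢ u).filter (fun p => p.2 < p.1)).card % 2 = 0) : esign t u = 1 :=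
  (Nat.even_iff.2 h).neg_one_pow

lemma esign_odd {t u : Finset (Fin 8)}
    (h : ((t ×ˢ u).filter (fun p => p.2 < p.1)).card % 2 = 1) : esign t u = -1 :=
  (Nat.odd_iff.2 h).neg_one_pow

lemma singleton_sdiff_mem {a : Fin 8} {t : Finset (Fin 8)} (h : {a} ⊆ t) : {a} \ t = ∅ := by
  simpa using h

lemma singleton_sdiff_notMem {a : Fin 8} {t : Finset (Fin 8)} (h : ¬ {a} ⊆ t) :
    {a} \ t = {a} := by
  simpa using h

lemma insert_sdiff_mem {a : Fin 8} {s t : Finset (Fin 8)} (h : {a} ⊆ t) :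
    insert a s \ t = s \ t :=
  Finset.insert_sdiff_of_mem s (by simpa using h)

lemma insert_sdiff_notMem {a : Fin 8} {s t : Finset (Fin 8)} (h : ¬ {a} ⊆ t) :
    insert a s \ t = insert a (s \ t) :=
  Finset.insert_sdiff_of_notMem s (by simpa using h)

lemma compl_eq_explicit (t : Finset (Fin 8)) : tᶜ = {0, 1, 2, 3, 4, 5, 6, 7} \ t := by
  rw [Finset.compl_eq_univ_sdiff]; rfl

/-- Degrees add under the wedge product. -/
lemma wedge_isForm {k l : ℕ} {α β : Form} (hα : IsForm k α) (hβ : IsForm l β) :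
    IsForm (k + l) (wedge α β) := by
  intro s hs
  refine Finset.sum_eq_zero fun t ht => ?_
  by_cases h1 : t.card = k
  · rw [hβ (s \ t) (fun h2 => hs ?_), mul_zero]
    rw [← h1, ← h2, add_comm, Finset.card_sdiff_add_card_eq_card (Finset.mem_powerset.1 ht)]
  · rw [hα t h1]; ring

/-- The Hodge star maps `k`-forms to `(8 - k)`-forms. -/
lemma hodge_isForm {k l : ℕ} (hkl : k + l = 8) {α : Form} (hα : IsForm k α) :
    IsForm l (hodge α) := by
  intro s hs
  have : sᶜ.card ≠ k := by
    have := Finset.card_add_card_compl s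
    simp only [Fintype.card_fin] at this
    omega
  simp [hodge, hα _ this]

lemma eS_isForm {k : ℕ} {q : Finset (Fin 8)} (h : q.card = k) : IsForm k (eS q) := by
  intro s hs
  have : s ≠ q := by rintro rfl; exact hs h
  simp [eS, this]

lemma IsForm.add' {k : ℕ} {α β : Form} (hα : IsForm k α) (hβ : IsForm k β) :
    IsForm k (α + β) := fun s hs => by simp [hα s hs, hβ s hs]

lemma IsForm.sub' {k : ℕ} {α β : Form} (hα : IsForm k α) (hβ : IsForm k β) :
    IsForm k (α - β) := fun s hs => by simp [hα s hs, hβ s hs]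

lemma IsForm.smul' {k : ℕ} {α : Form} (c : ℝ) (hα : IsForm k α) :
    IsForm k (c • α) := fun s hs => by simp [hα s hs]

lemma Phi_isForm : IsForm 4 Phi := by
  unfold Phi
  repeat' first
    | exact eS_isForm (by decide)
    | apply IsForm.sub'
    | apply IsForm.add'

set_option maxHeartbeats 8000000 in
lemma pair_case (η : Form) (i j : Fin 8) (hlt : i < j) :
    wedge (hodge (wedge Phi η)) Phi {i, j}ᶜ
      = ((9 : ℝ) • hodge (proj7 η) + hodge (proj21 η)) {i, j}ᶜ := by
  fin_cases i <;> fin_cases j <;> first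
    | exact absurd hlt (by decide)
    | (clear hlt
       simp (decide := true) only [Fin.zero_eta, Fin.mk_one, Fin.reduceFinMk, Fin.isValue,
        proj7, proj21, Phi, hodge, wedge_add_left,
        wedge_sub_left, wedge_add_right, wedge_sub_right, Pi.add_apply, Pi.sub_apply,
        Pi.smul_apply, smul_eq_mul, wedge_eS_left, wedge_eS_right, compl_eq_explicit,
        insert_sdiff_mem, insert_sdiff_notMem, singleton_sdiff_mem,
        singleton_sdiff_notMem, insert_empty_eq, if_true, if_false, esign_even, esign_odd]
       ring)

/-- for any 2-form η, with η⌟Φ := ⋆(Φ ∧ η),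
(η⌟Φ) ∧ Φ = 9 ⋆η_7 + ⋆η_21. -/
theorem two_form_contraction_wedge_phi (η : Form) (hη : IsForm 2 η) :
    wedge (hodge (wedge Phi η)) Phi = (9 : ℝ) • hodge (proj7 η) + hodge (proj21 η) := by
  have hT : IsForm 2 (hodge (wedge Phi η)) := hodge_isForm rfl (wedge_isForm Phi_isForm hη)
  have hL := wedge_isForm hT Phi_isForm
  have h7 : IsForm 2 (proj7 η) := (hη.add' hT).smul' _
  have h21 : IsForm 2 (proj21 η) := ((hη.smul' _).sub' hT).smul' _
  have hR : IsForm 6 ((9 : ℝ) • hodge (proj7 η) + hodge (proj21 η)) :=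
    ((hodge_isForm rfl h7).smul' _).add' (hodge_isForm rfl h21)
  funext s
  by_cases hs : s.card = 6
  swap
  · rw [hL s hs, hR s hs]
  have hc : sᶜ.card = 2 := by
    have := Finset.card_add_card_compl s
    simp only [Fintype.card_fin] at this
    omega
  obtain ⟨i, j, hij, hsc⟩ := Finset.card_eq_two.1 hc
  have hs' : s = {i, j}ᶜ := by rw [← hsc, compl_compl]
  subst hs'
  clear hs hc hsc
  wlog hlt : i < j generalizing i j
  · rw [Finset.pair_comm i j]
    exact this j i hij.symm (lt_of_le_of_ne (not_lt.1 hlt) hij.symm)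
  exact pair_case η i j hlt

end
end

section
/- For any 3-form γ on ℝ^8, defining γ • Φ := Σ_i (e_i⌟γ) ∧ (e_i⌟Φ) (sum over the standard orthonormal basis), one has γ • Φ = 7θ ∧ Φ - ⋆γ, where θ = (1/7)⋆(γ ∧ Φ). -/
open Finset

noncomputable section BulletHelpers

/-- Sparse integral forms: lists of monomials (index sets as bit masks) with integer
coefficients. -/
abbrev SForm := List (ℕ × ℤ)

/-- The index set encoded by a bit mask. -/
def maskSet (m : ℕ) : Finset (Fin 8) := Finset.univ.filter fun i => m.testBit i = true

theorem mem_maskSet (m : ℕ) (i : Fin 8) : i ∈ maskSet m ↔ m.testBit i = true := by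
  simp [maskSet]

theorem maskSet_or (a b : ℕ) : maskSet (a ||| b) = maskSet a ∪ maskSet b := by
  ext i; simp [mem_maskSet]

theorem testBit_255 : ∀ i : Fin 8, (255 : ℕ).testBit i = true := by decide

theorem maskSet_compl (a : ℕ) : maskSet (a ^^^ 255) = (maskSet a)ᶜ := by
  ext i; simp [mem_maskSet, testBit_255]

theorem maskSet_erase (a : ℕ) (i : Fin 8) (h : a.testBit i = true) :
    maskSet (a ^^^ 2 ^ (i : ℕ)) = (maskSet a).erase i := by
  ext j
  rw [Finset.mem_erase, mem_maskSet, mem_maskSet, Nat.testBit_xor, Nat.testBit_two_pow]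
  by_cases hij : i = j
  · subst hij; simp [h]
  · have h2 : (i : ℕ) ≠ j := fun e => hij (Fin.ext e)
    simp [h2, Ne.symm hij]

theorem maskSet_disjoint (a b : ℕ) :
    (a &&& b) % 256 = 0 ↔ Disjoint (maskSet a) (maskSet b) := by
  rw [Finset.disjoint_left]
  constructor
  · intro h i hi hj
    rw [mem_maskSet] at hi hj
    have h3 : ((a &&& b) % 2 ^ 8).testBit i = true := by
      rw [Nat.testBit_mod_two_pow, Nat.testBit_and, hi, hj]
      simp
    rw [show (2 ^ 8 : ℕ) = 256 from rfl, h] at h3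
    simp at h3
  · intro h
    apply Nat.eq_of_testBit_eq
    intro i
    rw [show (256 : ℕ) = 2 ^ 8 from rfl, Nat.testBit_mod_two_pow, Nat.testBit_and,
      Nat.zero_testBit]
    by_cases hi : i < 8
    · have h4 := @h ⟨i, hi⟩
      rw [mem_maskSet, mem_maskSet] at h4
      simp only at h4
      cases ha : a.testBit i <;> cases hb : b.testBit i <;> simp_all
    · simp [hi]

/-- The number of elements below `i` of the set encoded by `m`. -/
def belowN (m : ℕ) (i : Fin 8) : ℕ :=
  ∑ j : Fin 8, if m.testBit j = true ∧ j < i then 1 else 0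

theorem belowN_eq (m : ℕ) (i : Fin 8) :
    belowN m i = ((maskSet m).filter (· < i)).card := by
  rw [belowN, ← Finset.card_filter, maskSet, Finset.filter_filter]

/-- The number of inversions between two encoded sets. -/
def invN (a b : ℕ) : ℕ := ∑ i : Fin 8, if a.testBit i = true then belowN b i else 0

theorem invN_eq (a b : ℕ) :
    invN a b = ((maskSet a ×ˢ maskSet b).filter (fun p => p.2 < p.1)).card := by
  rw [invN, Finset.card_filter, Finset.sum_product, ← Finset.sum_filter]
  refine Finset.sum_congr rfl fun i _ => ?_
  rw [belowN_eq, Finset.card_filter]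

def evalS (L : SForm) : Form := (L.map (fun p => (p.2 : ℝ) • eS (maskSet p.1))).sum

def parityZ (n : ℕ) : ℤ := if n % 2 = 0 then 1 else -1

theorem parityZ_cast (n : ℕ) : ((parityZ n : ℤ) : ℝ) = (-1 : ℝ) ^ n := by
  unfold parityZ
  split_ifs with h
  · rw [Even.neg_one_pow (Nat.even_iff.2 h)]; simp
  · rw [Odd.neg_one_pow (Nat.odd_iff.2 (by omega))]; simp

def esignZ (a b : ℕ) : ℤ := parityZ (invN a b)

theorem esignZ_cast (a b : ℕ) :
    ((esignZ a b : ℤ) : ℝ) = esign (maskSet a) (maskSet b) := by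
  rw [esignZ, parityZ_cast, invN_eq, esign]

def wedgeLin : Form →ₗ[ℝ] Form →ₗ[ℝ] Form :=
  LinearMap.mk₂ ℝ wedge
    (by intro a b c; funext s
        simp only [wedge, Pi.add_apply, ← Finset.sum_add_distrib]
        exact Finset.sum_congr rfl fun _ _ => by ring)
    (by intro r a c; funext s
        simp only [wedge, Pi.smul_apply, smul_eq_mul, Finset.mul_sum]
        exact Finset.sum_congr rfl fun _ _ => by ring)
    (by intro a b c; funext s
        simp only [wedge, Pi.add_apply, ← Finset.sum_add_distrib]
        exact Finset.sum_congr rfl fun _ _ => by ring)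
    (by intro r a c; funext s
        simp only [wedge, Pi.smul_apply, smul_eq_mul, Finset.mul_sum]
        exact Finset.sum_congr rfl fun _ _ => by ring)

def hodgeLin : Form →ₗ[ℝ] Form where
  toFun := hodge
  map_add' a b := by funext s; simp only [hodge, Pi.add_apply]; ring
  map_smul' r a := by
    funext s; simp only [hodge, Pi.smul_apply, smul_eq_mul, RingHom.id_apply]; ring

def iotaLin (i : Fin 8) : Form →ₗ[ℝ] Form where
  toFun := iota i
  map_add' a b := by
    funext s; simp only [iota, Pi.add_apply]; split_ifs <;> ring
  map_smul' r a := by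
    funext s; simp only [iota, Pi.smul_apply, smul_eq_mul, RingHom.id_apply]
    split_ifs <;> ring

theorem wedge_eS (t u : Finset (Fin 8)) :
    wedge (eS t) (eS u) = if Disjoint t u then esign t u • eS (t ∪ u) else 0 := by
  funext s
  have h1 : wedge (eS t) (eS u) s = if t ⊆ s ∧ s \ t = u then esign t u else 0 := by
    unfold wedge eS
    by_cases hts : t ⊆ s
    · rw [Finset.sum_eq_single_of_mem t (Finset.mem_powerset.2 hts)]
      · by_cases hu : s \ t = u <;> simp [hts, hu]
      · intro b _ hb; simp [hb]
    · rw [Finset.sum_eq_zero]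
      · simp [hts]
      · intro b hb
        have : b ≠ t := by rintro rfl; exact hts (Finset.mem_powerset.1 hb)
        simp [this]
  rw [h1]
  by_cases hd : Disjoint t u
  · have : (t ⊆ s ∧ s \ t = u) ↔ s = t ∪ u := by
      constructor
      · rintro ⟨h, rfl⟩; exact (Finset.union_sdiff_of_subset h).symm
      · rintro rfl
        exact ⟨Finset.subset_union_left, Finset.union_sdiff_cancel_left hd⟩
    simp [this, hd, eS]
  · have : ¬ (t ⊆ s ∧ s \ t = u) := by
      rintro ⟨_, rfl⟩; exact hd Finset.disjoint_sdiff
    simp [this, hd]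

theorem hodge_eS (t : Finset (Fin 8)) : hodge (eS t) = esign t tᶜ • eS tᶜ := by
  funext s
  by_cases h : sᶜ = t
  · subst h; simp [hodge, eS]
  · have : s ≠ tᶜ := by rintro rfl; simp at h
    simp [hodge, eS, h, this]

theorem iota_eS (i : Fin 8) (t : Finset (Fin 8)) :
    iota i (eS t) = if i ∈ t then (-1 : ℝ) ^ (t.filter (· < i)).card • eS (t.erase i) else 0 := by
  funext s
  by_cases hit : i ∈ t
  · by_cases hs : s = t.erase i
    · subst hs
      have : (t.erase i).filter (· < i) = t.filter (· < i) := by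
        ext j; simp only [Finset.mem_filter, Finset.mem_erase]
        constructor
        · rintro ⟨⟨_, h⟩, hlt⟩; exact ⟨h, hlt⟩
        · rintro ⟨h, hlt⟩; exact ⟨⟨ne_of_lt hlt, h⟩, hlt⟩
      simp [iota, eS, hit, this]
    · have : i ∉ s → insert i s ≠ t := by
        rintro h rfl; exact hs (Finset.erase_insert h).symm
      by_cases his : i ∈ s
      · simp [iota, eS, hit, hs, his]
      · simp [iota, eS, hit, hs, his, this his]
  · have : insert i s ≠ t := by rintro rfl; simp at hit
    simp [iota, eS, hit, this]

def wedgeS (A B : SForm) : SForm :=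
  A.flatMap fun p => B.flatMap fun q =>
    if (p.1 &&& q.1) % 256 = 0 then [(p.1 ||| q.1, esignZ p.1 q.1 * p.2 * q.2)] else []

def hodgeS (A : SForm) : SForm := A.map fun p => (p.1 ^^^ 255, esignZ p.1 (p.1 ^^^ 255) * p.2)

def iotaS (i : Fin 8) (A : SForm) : SForm :=
  A.flatMap fun p =>
    if p.1.testBit i = true then [(p.1 ^^^ 2 ^ (i : ℕ), parityZ (belowN p.1 i) * p.2)] else []

def negS (A : SForm) : SForm := A.map fun p => (p.1, -p.2)

theorem evalS_nil : evalS [] = 0 := rfl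

theorem evalS_cons (p : ℕ × ℤ) (A : SForm) :
    evalS (p :: A) = (p.2 : ℝ) • eS (maskSet p.1) + evalS A := by simp [evalS]

theorem evalS_append (A B : SForm) : evalS (A ++ B) = evalS A + evalS B := by
  simp [evalS]

theorem evalS_neg (A : SForm) : evalS (negS A) = - evalS A := by
  induction A with
  | nil => simp [negS, evalS]
  | cons p A ih =>
    have : negS (p :: A) = (p.1, -p.2) :: negS A := rfl
    rw [this, evalS_cons, evalS_cons, ih]
    push_cast
    rw [neg_smul, neg_add]

theorem hodge_evalS (A : SForm) : evalS (hodgeS A) = hodgeLin (evalS A) := by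
  induction A with
  | nil => simp [hodgeS, evalS]
  | cons p A ih =>
    have : hodgeS (p :: A) = (p.1 ^^^ 255, esignZ p.1 (p.1 ^^^ 255) * p.2) :: hodgeS A := rfl
    rw [this, evalS_cons, evalS_cons, ih, map_add, map_smul]
    have h : hodgeLin (eS (maskSet p.1)) = _ := hodge_eS _
    rw [h, smul_smul]
    push_cast
    rw [esignZ_cast, maskSet_compl, mul_comm]

theorem iota_evalS (i : Fin 8) (A : SForm) : evalS (iotaS i A) = iotaLin i (evalS A) := by
  induction A with
  | nil => simp [iotaS, evalS]
  | cons p A ih =>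
    have : iotaS i (p :: A) =
      (if p.1.testBit i = true then [(p.1 ^^^ 2 ^ (i : ℕ), parityZ (belowN p.1 i) * p.2)] else [])
        ++ iotaS i A := rfl
    rw [this, evalS_append, evalS_cons, ih, map_add, map_smul]
    have h : iotaLin i (eS (maskSet p.1)) = _ := iota_eS i _
    rw [h]
    simp only [mem_maskSet]
    congr 1
    split_ifs with hi
    · rw [evalS_cons, evalS_nil, add_zero, smul_smul]
      push_cast
      rw [parityZ_cast, belowN_eq, maskSet_erase _ _ hi, mul_comm]
    · rw [evalS_nil, smul_zero]

theorem wedge_evalS_single (p : ℕ × ℤ) (B : SForm) :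
    evalS (B.flatMap fun q =>
      if (p.1 &&& q.1) % 256 = 0 then [(p.1 ||| q.1, esignZ p.1 q.1 * p.2 * q.2)] else [])
      = wedgeLin ((p.2 : ℝ) • eS (maskSet p.1)) (evalS B) := by
  induction B with
  | nil => simp [evalS]
  | cons q B ih =>
    rw [List.flatMap_cons, evalS_append, evalS_cons, ih, map_add]
    congr 1
    rw [map_smul, map_smul, LinearMap.smul_apply]
    have h : wedgeLin (eS (maskSet p.1)) (eS (maskSet q.1)) = _ := wedge_eS _ _
    rw [h]
    simp only [← maskSet_disjoint]
    split_ifs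
    · rw [evalS_cons, evalS_nil, add_zero, smul_smul, smul_smul]
      push_cast
      rw [esignZ_cast, maskSet_or]
      congr 1
      ring
    · rw [evalS_nil, smul_zero, smul_zero]

theorem wedge_evalS (A B : SForm) : evalS (wedgeS A B) = wedgeLin (evalS A) (evalS B) := by
  induction A with
  | nil => simp [wedgeS, evalS]
  | cons p A ih =>
    rw [evalS_cons, map_add, LinearMap.add_apply, ← ih, ← wedge_evalS_single, ← evalS_append]
    rfl

def PhiS : SForm :=
  [(15, 1), (51, -1), (195, -1), (85, -1), (165, 1),
   (153, -1), (105, -1), (240, 1), (204, -1), (60, -1),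
   (170, -1), (90, 1), (102, -1), (150, -1)]

theorem evalS_PhiS : evalS PhiS = Phi := by
  unfold PhiS Phi
  have m0 : maskSet 15 = {0,1,2,3} := by decide
  have m1 : maskSet 51 = {0,1,4,5} := by decide
  have m2 : maskSet 195 = {0,1,6,7} := by decide
  have m3 : maskSet 85 = {0,2,4,6} := by decide
  have m4 : maskSet 165 = {0,2,5,7} := by decide
  have m5 : maskSet 153 = {0,3,4,7} := by decide
  have m6 : maskSet 105 = {0,3,5,6} := by decide
  have m7 : maskSet 240 = {4,5,6,7} := by decide
  have m8 : maskSet 204 = {2,3,6,7} := by decide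
  have m9 : maskSet 60 = {2,3,4,5} := by decide
  have m10 : maskSet 170 = {1,3,5,7} := by decide
  have m11 : maskSet 90 = {1,3,4,6} := by decide
  have m12 : maskSet 102 = {1,2,5,6} := by decide
  have m13 : maskSet 150 = {1,2,4,7} := by decide
  simp only [evalS_cons, evalS_nil, m0, m1, m2, m3, m4, m5, m6, m7, m8, m9, m10, m11, m12, m13]
  push_cast
  module

/-- Difference of the two sides for the monomial with bit mask `T`. -/
def diffS (T : ℕ) : SForm :=
  (List.finRange 8).flatMap (fun i => wedgeS (iotaS i [(T, 1)]) (iotaS i PhiS)) ++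
    (negS (wedgeS (hodgeS (wedgeS [(T, 1)] PhiS)) PhiS) ++ hodgeS [(T, 1)])

def vanishS (A : SForm) : Bool :=
  A.all fun p => ((A.map fun q => if p.1 = q.1 then q.2 else 0).sum == 0)

/-- The coefficients of a sparse form, as a finitely supported function. -/
def coeffS (A : SForm) : ℕ →₀ ℝ := (A.map fun p => Finsupp.single p.1 (p.2 : ℝ)).sum

theorem coeffS_cons (p : ℕ × ℤ) (A : SForm) :
    coeffS (p :: A) = Finsupp.single p.1 (p.2 : ℝ) + coeffS A := by simp [coeffS]

theorem coeffS_apply (A : SForm) (m : ℕ) :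
    coeffS A m = (((A.map fun q => if m = q.1 then q.2 else 0).sum : ℤ) : ℝ) := by
  induction A with
  | nil => simp [coeffS]
  | cons p A ih =>
    rw [coeffS_cons, Finsupp.add_apply, ih, List.map_cons, List.sum_cons]
    push_cast
    simp [Finsupp.single_apply, eq_comm]

theorem evalS_eq_coeffS (A : SForm) :
    evalS A = Finsupp.linearCombination ℝ (fun m => eS (maskSet m)) (coeffS A) := by
  induction A with
  | nil => simp [evalS, coeffS]
  | cons p A ih =>
    rw [evalS_cons, coeffS_cons, map_add, Finsupp.linearCombination_single, ih]

theorem evalS_eq_zero (A : SForm) (h : vanishS A = true) : evalS A = 0 := by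
  have h0 : coeffS A = 0 := by
    ext s
    rw [coeffS_apply, Finsupp.zero_apply, Int.cast_eq_zero]
    by_cases hs : ∃ p ∈ A, p.1 = s
    · obtain ⟨p, hp, rfl⟩ := hs
      have := List.all_eq_true.1 h p hp
      simpa using this
    · push Not at hs
      apply List.sum_eq_zero
      intro x hx
      obtain ⟨q, hq, rfl⟩ := List.mem_map.1 hx
      rw [if_neg (hs q hq).symm]
  rw [evalS_eq_coeffS, h0, map_zero]

/-- The bit mask of a three-element set. -/
def mask3 (i j k : Fin 8) : ℕ := 2 ^ (i : ℕ) ||| 2 ^ (j : ℕ) ||| 2 ^ (k : ℕ)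

theorem maskSet_mask3 (i j k : Fin 8) : maskSet (mask3 i j k) = {i, j, k} := by
  ext l
  simp only [mem_maskSet, mask3, Nat.testBit_or, Nat.testBit_two_pow, Finset.mem_insert,
    Finset.mem_singleton, Bool.or_eq_true, decide_eq_true_eq, Fin.ext_iff]
  omega

theorem diffS_vanish_lt :
    ∀ i j k : Fin 8, i < j → j < k → vanishS (diffS (mask3 i j k)) = true := by
  decide +kernel

theorem exists_mask (T : Finset (Fin 8)) (hT : T.card = 3) :
    ∃ m, maskSet m = T ∧ vanishS (diffS m) = true := by
  let f := T.orderEmbOfFin hT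
  refine ⟨mask3 (f 0) (f 1) (f 2), ?_, diffS_vanish_lt _ _ _ ?_ ?_⟩
  · rw [maskSet_mask3]
    have h : Finset.univ.map f.toEmbedding = T := Finset.map_orderEmbOfFin_univ T hT
    rw [← h]
    ext l
    simp [Fin.exists_fin_succ, eq_comm]
  · exact f.strictMono (by decide)
  · exact f.strictMono (by decide)

theorem evalS_flatMap {ι : Type} (l : List ι) (f : ι → SForm) :
    evalS (l.flatMap f) = (l.map fun i => evalS (f i)).sum := by
  induction l with
  | nil => rfl
  | cons a l ih => rw [List.flatMap_cons, evalS_append, ih, List.map_cons, List.sum_cons]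

/-- Difference of the two sides as a linear map of the three-form. -/
def diffLin : Form →ₗ[ℝ] Form :=
  (∑ i : Fin 8, (wedgeLin.flip (iota i Phi)).comp (iotaLin i)) -
    ((wedgeLin.flip Phi).comp (hodgeLin.comp (wedgeLin.flip Phi)) - hodgeLin)

theorem diffLin_apply (γ : Form) : diffLin γ =
    (∑ i : Fin 8, wedge (iota i γ) (iota i Phi)) -
      (wedge (hodge (wedge γ Phi)) Phi - hodge γ) := by
  simp only [diffLin, LinearMap.sub_apply, LinearMap.sum_apply]
  rfl

theorem diffLin_eS (T : ℕ) : diffLin (eS (maskSet T)) = evalS (diffS T) := by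
  have hT : evalS [(T, 1)] = eS (maskSet T) := by
    rw [evalS_cons, evalS_nil]; simp
  unfold diffS
  rw [evalS_append, evalS_append, evalS_neg, evalS_flatMap, hodge_evalS, wedge_evalS,
    hodge_evalS, wedge_evalS, evalS_PhiS, hT]
  simp only [wedge_evalS, iota_evalS, evalS_PhiS, hT]
  rw [diffLin_apply, ← List.ofFn_eq_map, List.sum_ofFn, sub_eq_add_neg, neg_sub, sub_eq_neg_add]
  rfl

theorem diffLin_eq_zero (γ : Form) (hγ : IsForm 3 γ) : diffLin γ = 0 := by
  have h : γ = ∑ T : Finset (Fin 8), γ T • eS T := by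
    funext s
    simp [Finset.sum_apply, eS]
  rw [h, map_sum]
  apply Finset.sum_eq_zero
  intro T _
  rw [map_smul]
  by_cases hT : T.card = 3
  · obtain ⟨m, hm, hv⟩ := exists_mask T hT
    rw [← hm, diffLin_eS, evalS_eq_zero _ hv, smul_zero]
  · rw [hγ T hT, zero_smul]

end BulletHelpers

noncomputable section

/-- for any 3-form γ, with γ•Φ := Σᵢ (eᵢ⌟γ) ∧ (eᵢ⌟Φ) and
θ := (1/7) ⋆(γ ∧ Φ), one has γ•Φ = 7 θ ∧ Φ - ⋆γ. -/
theorem bullet_product_formula (γ : Form) (hγ : IsForm 3 γ) :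
    (∑ i : Fin 8, wedge (iota i γ) (iota i Phi)) =
      (7 : ℝ) • wedge ((7 : ℝ)⁻¹ • hodge (wedge γ Phi)) Phi - hodge γ := by
  have h := diffLin_eq_zero γ hγ
  rw [diffLin_apply, sub_eq_zero] at h
  have h7 : wedge ((7 : ℝ)⁻¹ • hodge (wedge γ Phi)) Phi =
      (7 : ℝ)⁻¹ • wedge (hodge (wedge γ Phi)) Phi := by
    change wedgeLin _ _ = _ • wedgeLin _ _
    rw [map_smul, LinearMap.smul_apply]
  rw [h, h7, smul_smul]
  norm_num

end
end
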